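/- arXiv:2406.00733 — 3 statements merged into one kernel-verified Lean document; each statement's English description precedes it below -/
import Mathlib

section
/- For two non-atomic countably additive finite measures μ_1, μ_2 on (M, Σ), there exists a measurable partition {A_1, A_2} of M which is a strong solution: μ_1(A_1) ≥ μ_1(A_2) and μ_2(A_2) ≥ μ_2(A_1). -/
open MeasureTheory

/-- A measure is non-atomic if every set of positive measure has a measurable subset of
strictly smaller positive measure. -/
def Nonatomic {α : Type*} [MeasurableSpace α] (μ : Measure α) : Prop :=
  ∀ A : Set α, MeasurableSet A → 0 < μ A →
    ∃ B ⊆ A, MeasurableSet B ∧ 0 < μ B ∧ μ B < μ A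

theorem small_real {α : Type*} [MeasurableSpace α] (μ : Measure α)
    [IsFiniteMeasure μ] (h : Nonatomic μ) (A : Set α) (hA : MeasurableSet A)
    (hp : 0 < μ.real A) (n : ℕ) :
    ∃ B ⊆ A, MeasurableSet B ∧ 0 < μ.real B ∧ μ.real B ≤ (1 / 2) ^ n * μ.real A := by
  induction n with
  | zero => exact ⟨A, subset_rfl, hA, hp, by simp⟩
  | succ n ih =>
    obtain ⟨B, hBA, hB, hB0, hBn⟩ := ih
    obtain ⟨C, hCB, hC, hC0, hC1⟩ := h B hB
      (by rw [measureReal_def] at hB0; exact (ENNReal.toReal_pos_iff.1 hB0).1)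
    have e : μ.real (B \ C) = μ.real B - μ.real C := measureReal_diff hCB hC
    have hc0 : 0 < μ.real C := ENNReal.toReal_pos hC0.ne' (measure_ne_top _ _)
    have hc1 : μ.real C < μ.real B :=
      (ENNReal.toReal_lt_toReal (measure_ne_top _ _) (measure_ne_top _ _)).2 hC1
    rw [pow_succ]
    by_cases hh : μ.real C ≤ μ.real B / 2
    · exact ⟨C, hCB.trans hBA, hC, hc0, by linarith⟩
    · exact ⟨B \ C, Set.diff_subset.trans hBA, hB.diff hC, by linarith, by linarith⟩

theorem exists_value {α : Type*} [MeasurableSpace α] (μ : Measure α)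
    [IsFiniteMeasure μ] (h : Nonatomic μ) (c : ℝ) (hc0 : 0 ≤ c) (hc : c ≤ μ.real Set.univ) :
    ∃ A, MeasurableSet A ∧ μ.real A = c := by
  have step : ∀ (n : ℕ) (A : {A : Set α // MeasurableSet A ∧ μ.real A ≤ c}),
      ∃ A' : {A : Set α // MeasurableSet A ∧ μ.real A ≤ c}, A.1 ⊆ A'.1 ∧
        ∀ B, MeasurableSet B → μ.real B ≤ c → A.1 ⊆ B →
          μ.real B ≤ μ.real A'.1 + 1 / ((n : ℝ) + 1) := by
    intro n A
    let S : Set ℝ := {x | ∃ B, MeasurableSet B ∧ μ.real B ≤ c ∧ A.1 ⊆ B ∧ μ.real B = x}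
    have hS : S.Nonempty := ⟨_, A.1, A.2.1, A.2.2, subset_rfl, rfl⟩
    have hb : BddAbove S := ⟨c, by rintro x ⟨B, _, h2, _, rfl⟩; exact h2⟩
    have hn : (0 : ℝ) < 1 / ((n : ℝ) + 1) := by positivity
    obtain ⟨x, ⟨B, hB, hBc, hAB, rfl⟩, hx⟩ :=
      exists_lt_of_lt_csSup hS (show sSup S - 1 / ((n : ℝ) + 1) < sSup S by linarith)
    refine ⟨⟨B, hB, hBc⟩, hAB, fun D hD hDc hAD => ?_⟩
    have := le_csSup hb (show μ.real D ∈ S from ⟨D, hD, hDc, hAD, rfl⟩)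
    simp only
    linarith
  choose f hf1 hf2 using step
  let u : ℕ → {A : Set α // MeasurableSet A ∧ μ.real A ≤ c} :=
    fun n => Nat.rec ⟨∅, MeasurableSet.empty, by simpa using hc0⟩ (fun n A => f n A) n
  have hu : ∀ n, u (n + 1) = f n (u n) := fun n => rfl
  have hmono : Monotone (fun n => (u n).1) :=
    monotone_nat_of_le_succ fun n => by rw [hu]; exact hf1 n (u n)
  have hUm : MeasurableSet (⋃ n, (u n).1) := MeasurableSet.iUnion fun n => (u n).2.1
  have hlim : Filter.Tendsto (fun n => μ.real (u n).1) Filter.atTop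
      (nhds (μ.real (⋃ n, (u n).1))) :=
    (ENNReal.tendsto_toReal (measure_ne_top _ _)).comp (tendsto_measure_iUnion_atTop hmono)
  have hle : μ.real (⋃ n, (u n).1) ≤ c := le_of_tendsto' hlim fun n => (u n).2.2
  refine ⟨_, hUm, ?_⟩
  by_contra hne
  have hlt := lt_of_le_of_ne hle hne
  set U := ⋃ n, (u n).1 with hU
  have hcompl : μ.real Uᶜ = μ.real Set.univ - μ.real U := measureReal_compl hUm
  have hpos : 0 < μ.real Uᶜ := by linarith
  obtain ⟨k, hk⟩ := exists_pow_lt_of_lt_one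
    (show 0 < (c - μ.real U) / μ.real Uᶜ from div_pos (by linarith) hpos)
    (show (1 / 2 : ℝ) < 1 by norm_num)
  rw [lt_div_iff₀ hpos] at hk
  obtain ⟨B, hBU, hB, hB0, hBk⟩ := small_real μ h Uᶜ hUm.compl hpos k
  have hUB : μ.real (U ∪ B) = μ.real U + μ.real B :=
    measureReal_union (Set.disjoint_left.2 fun x hx hx' => hBU hx' hx) hB
  obtain ⟨n, hn⟩ := exists_nat_one_div_lt hB0
  have h1 := hf2 n (u n) (U ∪ B) (hUm.union hB) (by linarith)
    ((Set.subset_iUnion (fun n => (u n).1) n).trans Set.subset_union_left)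
  rw [← hu] at h1
  have h2 : μ.real (u (n + 1)).1 ≤ μ.real U :=
    measureReal_mono (Set.subset_iUnion (fun n => (u n).1) (n + 1))
  linarith

/-- Cut-and-Choose: for two finite non-atomic measures there is a measurable partition
`{A₁, A₂}` of the space which is a strong (envy-free) solution. -/
theorem stmt6 {α : Type*} [MeasurableSpace α] (μ₁ μ₂ : Measure α)
    [IsFiniteMeasure μ₁] [IsFiniteMeasure μ₂]
    (h₁ : Nonatomic μ₁) (h₂ : Nonatomic μ₂) :
    ∃ A₁ A₂ : Set α, MeasurableSet A₁ ∧ MeasurableSet A₂ ∧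
      Disjoint A₁ A₂ ∧ A₁ ∪ A₂ = Set.univ ∧
      μ₁ A₂ ≤ μ₁ A₁ ∧ μ₂ A₁ ≤ μ₂ A₂ := by
  obtain ⟨A, hA, hc⟩ := exists_value μ₁ h₁ (μ₁.real Set.univ / 2)
    (by positivity) (by linarith [measureReal_nonneg (μ := μ₁) (s := Set.univ)])
  have e : μ₁.real Aᶜ = μ₁.real A := by rw [measureReal_compl hA]; linarith
  have e' : μ₁ Aᶜ = μ₁ A :=
    (ENNReal.toReal_eq_toReal_iff' (measure_ne_top _ _) (measure_ne_top _ _)).1 e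
  rcases le_total (μ₂ A) (μ₂ Aᶜ) with hh | hh
  · exact ⟨A, Aᶜ, hA, hA.compl, disjoint_compl_right, Set.union_compl_self A, e'.le, hh⟩
  · exact ⟨Aᶜ, A, hA.compl, hA, disjoint_compl_left, Set.compl_union_self A, e'.ge, hh⟩
end

section
/- Given non-atomic countably additive finite measures μ_1,...,μ_r on (M, Σ), for any index k and any measurable set S there exists a measurable subset H ⊆ S with μ_k(H) ≥ 2^{-(r-1)} μ_k(S) such that H admits a strong solution to the fair division problem, i.e. a measurable partition {F_1,...,F_r} of H with μ_i(F_i) ≥ μ_i(F_j) for all i, j. -/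
open MeasureTheory

section helpers

variable {α : Type*} [MeasurableSpace α]

lemma na_small (m : Measure α) [IsFiniteMeasure m] (h : Nonatomic m) (n : ℕ) :
    ∀ A : Set α, MeasurableSet A → 0 < m.real A →
      ∃ B ⊆ A, MeasurableSet B ∧ 0 < m.real B ∧ m.real B ≤ m.real A / 2 ^ n := by
  induction n with
  | zero => intro A hA hp; exact ⟨A, subset_rfl, hA, hp, by simp⟩
  | succ n ih =>
    intro A hA hp
    obtain ⟨C, hCA, hC, hC0, hCl⟩ := ih A hA hp
    have hC0' : 0 < m C := by
      rw [pos_iff_ne_zero]; intro h0; simp [Measure.real, h0] at hC0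
    obtain ⟨D, hDC, hD, hD0, hDl⟩ := h C hC hC0'
    have hD1 : 0 < m.real D := ENNReal.toReal_pos hD0.ne' (measure_ne_top _ _)
    have hD2 : m.real D < m.real C :=
      (ENNReal.toReal_lt_toReal (measure_ne_top _ _) (measure_ne_top _ _)).2 hDl
    have hdiff : m.real (C \ D) = m.real C - m.real D := measureReal_sdiff hDC hD
    have e : m.real A / 2 ^ (n + 1) = (m.real A / 2 ^ n) / 2 := by rw [pow_succ]; field_simp
    rcases le_total (m.real D) (m.real C / 2) with hh | hh
    · exact ⟨D, hDC.trans hCA, hD, hD1, by rw [e]; linarith⟩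
    · exact ⟨C \ D, Set.sdiff_subset.trans hCA, hC.diff hD, by linarith, by rw [e]; linarith⟩

lemma na_exact (m : Measure α) [IsFiniteMeasure m] (h : Nonatomic m) (A : Set α)
    (hA : MeasurableSet A) (c : ℝ) (hc0 : 0 ≤ c) (hc : c ≤ m.real A) :
    ∃ B ⊆ A, MeasurableSet B ∧ m.real B = c := by
  let X := {B : Set α // MeasurableSet B ∧ B ⊆ A ∧ m.real B ≤ c}
  have step : ∀ B : X, ∃ B' : X, B.1 ⊆ B'.1 ∧ ∀ D : X, B.1 ⊆ D.1 →
      m.real D.1 - m.real B.1 ≤ 2 * (m.real B'.1 - m.real B.1) := by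
    intro B
    let V : Set ℝ := {x | ∃ D : X, B.1 ⊆ D.1 ∧ m.real D.1 = x}
    have hne : V.Nonempty := ⟨_, B, subset_rfl, rfl⟩
    have hbdd : BddAbove V := ⟨c, by rintro _ ⟨D, _, rfl⟩; exact D.2.2.2⟩
    have hle : ∀ D : X, B.1 ⊆ D.1 → m.real D.1 ≤ sSup V := fun D hD => le_csSup hbdd ⟨D, hD, rfl⟩
    rcases (hle B subset_rfl).eq_or_lt with he | hl
    · refine ⟨B, subset_rfl, fun D hD => ?_⟩
      have := hle D hD
      linarith
    · obtain ⟨_, ⟨D, hBD, rfl⟩, hx⟩ := exists_lt_of_lt_csSup hne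
        (show (sSup V + m.real B.1) / 2 < sSup V by linarith)
      refine ⟨D, hBD, fun E hE => ?_⟩
      have := hle E hE
      linarith
  choose f hf1 hf2 using step
  let x0 : X := ⟨∅, MeasurableSet.empty, Set.empty_subset _, by simpa using hc0⟩
  let b : ℕ → X := fun n => f^[n] x0
  have hb : ∀ n, b (n + 1) = f (b n) := fun n => Function.iterate_succ_apply' f n x0
  have hmono : Monotone (fun n => (b n).1) := monotone_nat_of_le_succ fun n => by
    show (b n).1 ⊆ (b (n + 1)).1
    rw [hb]; exact hf1 _
  let U := ⋃ n, (b n).1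
  have hU : MeasurableSet U := MeasurableSet.iUnion fun n => (b n).2.1
  have hUA : U ⊆ A := Set.iUnion_subset fun n => (b n).2.2.1
  have hlim : Filter.Tendsto (fun n => m.real (b n).1) Filter.atTop (nhds (m.real U)) :=
    (ENNReal.tendsto_toReal (measure_ne_top m U)).comp (tendsto_measure_iUnion_atTop hmono)
  have hUc : m.real U ≤ c := le_of_tendsto' hlim fun n => (b n).2.2.2
  refine ⟨U, hUA, hU, hUc.eq_or_lt.resolve_right fun hlt => ?_⟩
  have hd : m.real (A \ U) = m.real A - m.real U := measureReal_sdiff hUA hU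
  have hpos : 0 < m.real (A \ U) := by linarith
  obtain ⟨n, hn⟩ := pow_unbounded_of_one_lt (m.real (A \ U) / (c - m.real U)) (one_lt_two (α := ℝ))
  obtain ⟨D, hDA, hD, hD0, hDl⟩ := na_small m h n _ (hA.diff hU) hpos
  have hDc : m.real D ≤ c - m.real U := by
    refine hDl.trans ?_
    rw [div_lt_iff₀ (by linarith)] at hn
    rw [div_le_iff₀ (by positivity)]
    linarith
  have hdisj : Disjoint U D := Set.disjoint_left.2 fun x hx hxD => (hDA hxD).2 hx
  have hUD : m.real (U ∪ D) = m.real U + m.real D := measureReal_union hdisj hD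
  let E : X := ⟨U ∪ D, hU.union hD, Set.union_subset hUA (hDA.trans Set.sdiff_subset), by linarith⟩
  have key : ∀ n, m.real (U ∪ D) - m.real (b n).1
      ≤ 2 * (m.real (b (n + 1)).1 - m.real (b n).1) := fun n => by
    rw [hb]
    exact hf2 (b n) E ((Set.subset_iUnion (fun n => (b n).1) n).trans Set.subset_union_left)
  have hlim' := hlim.comp (Filter.tendsto_add_atTop_nat 1)
  have := le_of_tendsto_of_tendsto' (hlim.const_sub (m.real (U ∪ D)))
    ((hlim'.sub hlim).const_mul 2) key
  linarith

lemma na_cut (m : Measure α) [IsFiniteMeasure m] (h : Nonatomic m) (c : ℝ) (hc : 0 ≤ c) (n : ℕ) :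
    ∀ A : Set α, MeasurableSet A → n * c ≤ m.real A →
      ∃ P : Fin n → Set α, (∀ i, P i ⊆ A) ∧ (∀ i, MeasurableSet (P i)) ∧
        (∀ i j, i ≠ j → Disjoint (P i) (P j)) ∧ ∀ i, m.real (P i) = c := by
  induction n with
  | zero => intro A _ _; exact ⟨fun _ => ∅, by simp, by simp, by simp, fun i => i.elim0⟩
  | succ n ih =>
    intro A hA hle
    push_cast at hle
    have : 0 ≤ n * c := by positivity
    obtain ⟨B, hBA, hB, hBc⟩ := na_exact m h A hA c hc (by linarith)
    have hd : m.real (A \ B) = m.real A - m.real B := measureReal_sdiff hBA hB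
    obtain ⟨P, h1, h2, h3, h4⟩ := ih (A \ B) (hA.diff hB) (by linarith)
    have hdis : ∀ i, Disjoint B (P i) := fun i =>
      Set.disjoint_left.2 fun x hx hxD => (h1 i hxD).2 hx
    refine ⟨Fin.cons B P, ?_, ?_, ?_, ?_⟩
    · intro i; cases i using Fin.cases
      · simpa using hBA
      · simpa using (h1 _).trans Set.sdiff_subset
    · intro i; cases i using Fin.cases
      · simpa using hB
      · simpa using h2 _
    · intro i j hij
      cases i using Fin.cases <;> cases j using Fin.cases
      · exact absurd rfl hij
      · simpa using hdis _
      · simpa using (hdis _).symm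
      · simpa using h3 _ _ (fun e => hij (by rw [e]))
    · intro i; cases i using Fin.cases
      · simpa using hBc
      · simpa using h4 _

lemma top_set {ι : Type*} [Fintype ι] [DecidableEq ι] (v : ι → ℝ) (N : ℕ) (hN : N ≤ Fintype.card ι) :
    ∃ Q : Finset ι, Q.card = N ∧ ∀ q ∈ Q, ∀ t ∉ Q, v t ≤ v q := by
  induction N with
  | zero => exact ⟨∅, by simp, by simp⟩
  | succ N ih =>
    obtain ⟨Q, hQ, hv⟩ := ih (by omega)
    have hne : Qᶜ.Nonempty := by
      rw [← Finset.card_pos, Finset.card_compl]; omega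
    obtain ⟨x, hx, hmax⟩ := Finset.exists_max_image Qᶜ v hne
    have hx' : x ∉ Q := by simpa using hx
    refine ⟨insert x Q, by rw [Finset.card_insert_of_notMem hx', hQ], ?_⟩
    intro q hq t ht
    simp only [Finset.mem_insert, not_or] at hq ht
    rcases hq with rfl | hq
    · exact hmax t (by simpa using ht.2)
    · exact hv q hq t ht.2

lemma trim {ι : Type*} [Fintype ι] [DecidableEq ι] (m : Measure α) [IsFiniteMeasure m]
    (h : Nonatomic m) (A : ι → Set α) (hA : ∀ t, MeasurableSet (A t)) (N : ℕ) (hN0 : 0 < N)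
    (hN : N ≤ Fintype.card ι) :
    ∃ (B : ι → Set α) (Q R : Finset ι), (∀ t, MeasurableSet (B t)) ∧ (∀ t, B t ⊆ A t) ∧
      Q.card = N ∧ R.card + 1 = N ∧ (∀ t ∉ R, B t = A t) ∧
      ∀ q ∈ Q, ∀ t, m.real (B t) ≤ m.real (B q) := by
  obtain ⟨Q, hQ, hv⟩ := top_set (fun t => m.real (A t)) N hN
  obtain ⟨q0, hq0, hmin⟩ := Finset.exists_min_image Q (fun t => m.real (A t))
    (by rw [← Finset.card_pos]; omega)
  have : ∀ t, ∃ B ⊆ A t, MeasurableSet B ∧ (t ∈ Q → m.real B = m.real (A q0)) ∧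
      (t ∉ Q.erase q0 → B = A t) := by
    intro t
    by_cases ht : t ∈ Q.erase q0
    · obtain ⟨B, h1, h2, h3⟩ := na_exact m h (A t) (hA t) (m.real (A q0)) measureReal_nonneg
        (hmin t (Finset.mem_of_mem_erase ht))
      exact ⟨B, h1, h2, fun _ => h3, fun h => absurd ht h⟩
    · refine ⟨A t, subset_rfl, hA t, fun hQt => ?_, fun _ => rfl⟩
      have : t = q0 := by by_contra hne; exact ht (Finset.mem_erase.2 ⟨hne, hQt⟩)
      rw [this]
  choose B h1 h2 h3 h4 using this
  refine ⟨B, Q, Q.erase q0, h2, h1, hQ, by rw [Finset.card_erase_of_mem hq0]; omega, h4, ?_⟩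
  intro q hq t
  rw [h3 q hq]
  by_cases ht : t ∈ Q
  · rw [h3 t ht]
  · rw [h4 t (fun h => ht (Finset.mem_of_mem_erase h))]
    exact hv q0 hq0 t ht

lemma protocol {ι κ : Type*} [Fintype ι] [DecidableEq ι] [DecidableEq κ] [Nonempty ι]
    (μ : κ → Measure α) (hfin : ∀ i, IsFiniteMeasure (μ i)) (hna : ∀ i, Nonatomic (μ i))
    (s : Finset κ) : ∀ A : ι → Set α, (∀ t, MeasurableSet (A t)) → 2 ^ s.card ≤ Fintype.card ι →
      ∃ (B : ι → Set α) (σ : κ → ι) (T : Finset ι), (∀ t, MeasurableSet (B t)) ∧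
        (∀ t, B t ⊆ A t) ∧ T.card + 1 ≤ 2 ^ s.card ∧ (∀ t ∉ T, B t = A t) ∧
        (∀ i ∈ s, σ i ∈ T) ∧ (∀ i ∈ s, ∀ j ∈ s, σ i = σ j → i = j) ∧
        ∀ i ∈ s, ∀ t, (μ i).real (B t) ≤ (μ i).real (B (σ i)) := by
  induction s using Finset.induction_on with
  | empty =>
    intro A hA _
    exact ⟨A, fun _ => Classical.arbitrary ι, ∅, hA, fun _ => subset_rfl, by simp, by simp,
      by simp, by simp, by simp⟩
  | insert p s hp ih =>
    intro A hA hcard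
    rw [Finset.card_insert_of_notMem hp, pow_succ] at *
    have hpos : 0 < 2 ^ s.card := by positivity
    have := hfin p
    obtain ⟨A', Q, R, a1, a2, a3, a4, a5, a6⟩ :=
      trim (μ p) (hna p) A hA (2 ^ s.card) hpos (by omega)
    obtain ⟨B, σ, T, b1, b2, b3, b4, b5, b6, b7⟩ := ih A' a1 (by omega)
    obtain ⟨q, hq, hqT⟩ := Finset.exists_mem_notMem_of_card_lt_card (show T.card < Q.card by omega)
    have hσ : ∀ i ∈ s, Function.update σ p q i = σ i := fun i hi =>
      Function.update_of_ne (fun e : i = p => hp (e ▸ hi)) _ _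
    refine ⟨B, Function.update σ p q, insert q (T ∪ R), b1, fun t => (b2 t).trans (a2 t), ?_, ?_,
      ?_, ?_, ?_⟩
    · have h1 := Finset.card_insert_le q (T ∪ R)
      have h2 := Finset.card_union_le T R
      omega
    · intro t ht
      simp only [Finset.mem_insert, Finset.mem_union, not_or] at ht
      rw [b4 t ht.2.1, a5 t ht.2.2]
    · intro i hi
      rcases Finset.mem_insert.1 hi with rfl | hi
      · simp
      · rw [hσ i hi]; simp [b5 i hi]
    · intro i hi j hj
      rcases Finset.mem_insert.1 hi with hip | his <;>
        rcases Finset.mem_insert.1 hj with hjp | hjs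
      · intro _; rw [hip, hjp]
      · rw [hip, hσ j hjs, Function.update_self]
        intro e; exact absurd (e ▸ b5 j hjs) hqT
      · rw [hjp, hσ i his, Function.update_self]
        intro e; exact absurd (e ▸ b5 i his) hqT
      · rw [hσ i his, hσ j hjs]; exact b6 i his j hjs
    · intro i hi t
      rcases Finset.mem_insert.1 hi with rfl | hi
      · rw [Function.update_self, b4 q hqT]
        exact (measureReal_mono (b2 t)).trans (a6 q hq t)
      · rw [hσ i hi]; exact b7 i hi t

end helpers

/-- From any measurable set `S` one can extract a measurable subset `H` of `μ_k`-measure at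
least `2^{-(r-1)} μ_k(S)` which admits a strong solution to the fair division problem. -/
theorem stmt8 {α : Type*} [MeasurableSpace α] (r : ℕ) (hr : 1 ≤ r)
    (μ : Fin r → Measure α)
    (hfin : ∀ i, IsFiniteMeasure (μ i)) (hna : ∀ i, Nonatomic (μ i))
    (k : Fin r) (S : Set α) (hS : MeasurableSet S) :
    ∃ H ⊆ S, MeasurableSet H ∧
      μ k S / 2 ^ (r - 1) ≤ μ k H ∧
      ∃ F : Fin r → Set α,
        (∀ i, MeasurableSet (F i)) ∧
        Pairwise (Function.onFun Disjoint F) ∧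
        (⋃ i, F i) = H ∧
        ∀ i j, μ i (F j) ≤ μ i (F i) := by
  have := hfin k
  set c : ℝ := (μ k).real S / 2 ^ (r - 1) with hc
  have hc0 : 0 ≤ c := by positivity
  obtain ⟨P, p1, p2, p3, p4⟩ := na_cut (μ k) (hna k) c hc0 (2 ^ (r - 1)) S hS (by
    rw [hc]; push_cast; rw [mul_div_cancel₀ _ (by positivity)])
  have hs : (Finset.univ.erase k).card = r - 1 := by
    rw [Finset.card_erase_of_mem (Finset.mem_univ _)]; simp
  have : Nonempty (Fin (2 ^ (r - 1))) := ⟨⟨0, by positivity⟩⟩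
  obtain ⟨B, σ, T, b1, b2, b3, b4, b5, b6, b7⟩ :=
    protocol μ hfin hna (Finset.univ.erase k) P p2 (by rw [hs]; simp)
  rw [hs] at b3
  obtain ⟨q, -, hqT⟩ := Finset.exists_mem_notMem_of_card_lt_card
    (show T.card < (Finset.univ : Finset (Fin (2 ^ (r - 1)))).card by simp; omega)
  have hmem : ∀ i, i ≠ k → i ∈ Finset.univ.erase k := fun i hi => by simp [hi]
  have hσk : Function.update σ k q k = q := by simp
  have hσ : ∀ i, i ≠ k → Function.update σ k q i = σ i := fun i hi =>
    Function.update_of_ne hi _ _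
  set τ := Function.update σ k q
  have hinj : ∀ i j, τ i = τ j → i = j := by
    intro i j h
    by_cases hi : i = k <;> by_cases hj : j = k
    · rw [hi, hj]
    · rw [hi, hσk, hσ j hj] at h
      exact absurd (h ▸ b5 j (hmem j hj)) hqT
    · rw [hj, hσk, hσ i hi] at h
      exact absurd (h ▸ b5 i (hmem i hi)) hqT
    · rw [hσ i hi, hσ j hj] at h
      exact b6 i (hmem i hi) j (hmem j hj) h
  have hkq : (μ k).real (B q) = c := by rw [b4 q hqT, p4]
  refine ⟨⋃ i, B (τ i), Set.iUnion_subset fun i => (b2 _).trans (p1 _),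
    MeasurableSet.iUnion fun i => b1 _, ?_, fun i => B (τ i), fun i => b1 _, ?_, rfl, ?_⟩
  · have h1 : μ k (B q) ≤ μ k (⋃ i, B (τ i)) := by
      have := measure_mono (μ := μ k) (Set.subset_iUnion (fun i => B (τ i)) k)
      simpa only [hσk] using this
    refine le_trans (le_of_eq ?_) h1
    rw [← ENNReal.toReal_eq_toReal_iff' (ENNReal.div_ne_top (measure_ne_top _ _) (by positivity))
      (measure_ne_top _ _)]
    change _ = (μ k).real (B q)
    rw [hkq, hc]
    simp [Measure.real, ENNReal.toReal_div]
  · intro i j hij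
    exact (p3 _ _ fun e => hij (hinj i j e)).mono (b2 _) (b2 _)
  · intro i j
    have := hfin i
    rw [← ENNReal.toReal_le_toReal (measure_ne_top _ _) (measure_ne_top _ _)]
    change (μ i).real (B (τ j)) ≤ (μ i).real (B (τ i))
    by_cases hi : i = k
    · subst hi
      rw [hσk, hkq, ← p4 (τ j)]
      exact measureReal_mono (b2 _)
    · rw [hσ i hi]; exact b7 i (hmem i hi) _
end

section
/- Let μ_1,...,μ_r be finite non-atomic countably additive measures on M and S a measurable set with μ_i(S) > 0 for all i. Then there exist pairwise disjoint measurable sets R^1,...,R^r with ⊔_k R^k ⊆ S and a permutation l_1,...,l_r of {1,...,r} such that μ_{l_k}(R^k) = (1/r) μ_{l_k}(S) for each k, and μ_{l_j}(R^k) ≤ (1/r) μ_{l_j}(S) for all j > k. -/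
open MeasureTheory

/-- Existence of extreme points, in a Hilbert space, for weakly closed bounded sets. -/
lemma exists_extreme_hilbert {H : Type*} [NormedAddCommGroup H] [InnerProductSpace ℝ H]
    [CompleteSpace H] (Q : Set (H × ℝ)) (C : ℝ)
    (hb : ∀ f : H, (∀ p ∈ Q, inner ℝ p.1 f ≤ p.2) → ‖f‖ ≤ C)
    (hne : ∃ f : H, ∀ p ∈ Q, inner ℝ p.1 f ≤ p.2) :
    ∃ f : H, (∀ p ∈ Q, inner ℝ p.1 f ≤ p.2) ∧
      ∀ h : H, (∀ p ∈ Q, inner ℝ p.1 (f + h) ≤ p.2) →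
        (∀ p ∈ Q, inner ℝ p.1 (f - h) ≤ p.2) → h = 0 := by
  let K : Set (WeakDual ℝ H) := ⋂ p ∈ Q, {φ | φ p.1 ≤ p.2}
  have hcl : IsClosed K := isClosed_biInter fun p _ =>
    isClosed_le (WeakDual.eval_continuous p.1) continuous_const
  have key : ∀ f : H, (StrongDual.toWeakDual (InnerProductSpace.toDual ℝ H f)) ∈ K ↔
      ∀ p ∈ Q, inner ℝ p.1 f ≤ p.2 := by
    intro f
    simp only [K, Set.mem_iInter, Set.mem_ofPred_eq]
    refine forall₂_congr fun p _ => ?_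
    rw [real_inner_comm]
    exact Iff.rfl
  have hsub : K ⊆ WeakDual.toStrongDual ⁻¹' Metric.closedBall 0 C := by
    intro φ hφ
    obtain ⟨f, hf⟩ := (InnerProductSpace.toDual ℝ H).surjective (WeakDual.toStrongDual φ)
    have h1 : φ = StrongDual.toWeakDual (InnerProductSpace.toDual ℝ H f) := by
      rw [hf]; rfl
    rw [h1] at hφ
    have := hb f ((key f).1 hφ)
    rw [Set.mem_preimage, ← hf, mem_closedBall_zero_iff, LinearIsometryEquiv.norm_map]
    exact this
  have hcomp : IsCompact K := (WeakDual.isCompact_closedBall 0 C).of_isClosed_subset hcl hsub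
  have : LocallyConvexSpace ℝ (WeakDual ℝ H) :=
    inferInstanceAs (LocallyConvexSpace ℝ (WeakBilin (topDualPairing ℝ H)))
  have : ContinuousSMul ℝ (WeakDual ℝ H) :=
    inferInstanceAs (ContinuousSMul ℝ (WeakBilin (topDualPairing ℝ H)))
  obtain ⟨φ, hφ⟩ := hcomp.extremePoints_nonempty (by
    obtain ⟨f, hf⟩ := hne
    exact ⟨_, (key f).2 hf⟩)
  obtain ⟨f, hf⟩ := (InnerProductSpace.toDual ℝ H).surjective (WeakDual.toStrongDual φ)
  have h1 : φ = StrongDual.toWeakDual (InnerProductSpace.toDual ℝ H f) := by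
    rw [hf]; rfl
  rw [h1, mem_extremePoints] at hφ
  refine ⟨f, (key f).1 hφ.1, fun h hp hm => ?_⟩
  have h2 := (hφ.2 _ ((key _).2 hp) _ ((key _).2 hm) ?_).1
  · have h3 := (InnerProductSpace.toDual ℝ H).injective (StrongDual.toWeakDual.injective h2)
    simpa using h3
  · refine ⟨1/2, 1/2, by norm_num, by norm_num, by norm_num, ?_⟩
    refine ContinuousLinearMap.ext fun x => ?_
    change (1/2:ℝ) * inner ℝ (f + h) x + (1/2:ℝ) * inner ℝ (f - h) x = inner ℝ f x
    rw [inner_add_left, inner_sub_left]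
    ring

lemma exists_pieces {α : Type*} [MeasurableSpace α] (ν : Measure α)
    (hν : ∀ A : Set α, MeasurableSet A → 0 < ν A →
      ∃ B ⊆ A, MeasurableSet B ∧ 0 < ν B ∧ 0 < ν (A \ B)) (n : ℕ) :
    ∀ A : Set α, MeasurableSet A → 0 < ν A →
      ∃ E : Fin n → Set α, (∀ k, E k ⊆ A) ∧ (∀ k, MeasurableSet (E k)) ∧
        (∀ k, 0 < ν (E k)) ∧ Pairwise (Function.onFun Disjoint E) := by
  induction n with
  | zero => exact fun A _ _ => ⟨fun _ => ∅, fun k => k.elim0, fun k => k.elim0, fun k => k.elim0,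
      fun k => k.elim0⟩
  | succ n ih =>
    intro A hA hpos
    obtain ⟨B, hBA, hB, hB0, hAB⟩ := hν A hA hpos
    obtain ⟨E, h1, h2, h3, h4⟩ := ih (A \ B) (hA.diff hB) hAB
    have hd : ∀ k, Disjoint B (E k) := fun k =>
      Set.disjoint_left.2 fun x hx hx' => (h1 k hx').2 hx
    refine ⟨Fin.cons B E, ?_, ?_, ?_, ?_⟩
    · exact Fin.cases hBA fun k => (h1 k).trans Set.sdiff_subset
    · exact Fin.cases hB h2
    · exact Fin.cases hB0 h3
    · intro i j
      refine Fin.cases ?_ (fun i => ?_) i <;> refine Fin.cases ?_ (fun j => ?_) j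
      · exact fun h => absurd rfl h
      · exact fun _ => hd j
      · exact fun _ => (hd i).symm
      · exact fun h => h4 (i := i) (j := j) fun hij => h (congrArg Fin.succ hij)

/-- The values in `[0,1]`, tested against indicators. -/
lemma ae_mem_unit_iff {α : Type*} [MeasurableSpace α] (ν : Measure α) [IsFiniteMeasure ν]
    (f : Lp ℝ 2 ν) :
    (∀ A (hA : MeasurableSet A),
      inner ℝ (indicatorConstLp 2 hA (measure_ne_top ν A) (1:ℝ)) f ≤ ν.real A ∧
      0 ≤ inner ℝ (indicatorConstLp 2 hA (measure_ne_top ν A) (1:ℝ)) f) ↔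
    ∀ᵐ x ∂ν, 0 ≤ f x ∧ f x ≤ 1 := by
  have hint : Integrable f ν := (Lp.memLp f).integrable (by norm_num)
  simp only [L2.inner_indicatorConstLp_one]
  constructor
  · intro h
    have h0 := ae_nonneg_of_forall_setIntegral_nonneg hint fun s hs _ => (h s hs).2
    have h1 := ae_le_of_forall_setIntegral_le hint (integrable_const (1:ℝ)) fun s hs _ => by
      simpa using (h s hs).1
    filter_upwards [h0, h1] with x a b using ⟨a, b⟩
  · intro h A hA
    constructor
    · have : ∫ x in A, f x ∂ν ≤ ∫ x in A, (1:ℝ) ∂ν := by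
        refine integral_mono_ae hint.integrableOn (integrable_const _) ?_
        filter_upwards [ae_restrict_of_ae h] with x hx using hx.2
      simpa using this
    · refine integral_nonneg_of_ae ?_
      filter_upwards [ae_restrict_of_ae h] with x hx using hx.1

/-- Lyapunov's theorem, in the form we need, for square-integrable densities. -/
lemma lyapunov_density {α : Type*} [MeasurableSpace α] (ν : Measure α) [IsFiniteMeasure ν]
    (hν : ∀ A : Set α, MeasurableSet A → 0 < ν A →
      ∃ B ⊆ A, MeasurableSet B ∧ 0 < ν B ∧ 0 < ν (A \ B)) (n : ℕ)
    (ρ : Fin n → Lp ℝ 2 ν) (t : ℝ) (ht0 : 0 ≤ t) (ht1 : t ≤ 1) :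
    ∃ A, MeasurableSet A ∧ ∀ i, ∫ x in A, ρ i x ∂ν = t * ∫ x, ρ i x ∂ν := by
  let I : ∀ A : Set α, MeasurableSet A → Lp ℝ 2 ν :=
    fun A hA => indicatorConstLp 2 hA (measure_ne_top ν A) (1:ℝ)
  let c : Fin n → ℝ := fun i => t * ∫ x, ρ i x ∂ν
  let Q : Set (Lp ℝ 2 ν × ℝ) :=
    {p | ∃ A, ∃ hA : MeasurableSet A, p = (I A hA, ν.real A) ∨ p = (- I A hA, 0)} ∪
    {p | ∃ i, p = (ρ i, c i) ∨ p = (- ρ i, - c i)}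
  have hQ : ∀ f : Lp ℝ 2 ν, (∀ p ∈ Q, inner ℝ p.1 f ≤ p.2) ↔
      (∀ᵐ x ∂ν, 0 ≤ f x ∧ f x ≤ 1) ∧ ∀ i, inner ℝ (ρ i) f = c i := by
    intro f
    rw [← ae_mem_unit_iff]
    constructor
    · intro h
      refine ⟨fun A hA => ⟨h _ (Or.inl ⟨A, hA, Or.inl rfl⟩), ?_⟩, fun i => le_antisymm
        (h _ (Or.inr ⟨i, Or.inl rfl⟩)) ?_⟩
      · have := h _ (Or.inl ⟨A, hA, Or.inr rfl⟩)
        simp only [inner_neg_left] at this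
        linarith
      · have := h _ (Or.inr ⟨i, Or.inr rfl⟩)
        simp only [inner_neg_left] at this
        linarith
    · rintro ⟨h1, h2⟩ p (⟨A, hA, rfl | rfl⟩ | ⟨i, rfl | rfl⟩)
      · exact (h1 A hA).1
      · have := (h1 A hA).2
        simp only [inner_neg_left]
        linarith
      · exact (h2 i).le
      · simp [inner_neg_left, h2 i]
  obtain ⟨f, hf, hext⟩ := exists_extreme_hilbert Q
    (ν.real Set.univ ^ ((2:ENNReal).toReal)⁻¹ * 1) (by
      intro f hf
      refine Lp.norm_le_of_ae_bound zero_le_one ?_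
      filter_upwards [((hQ f).1 hf).1] with x hx
      rw [Real.norm_eq_abs, abs_le]
      constructor <;> linarith [hx.1, hx.2]) (by
      refine ⟨t • I Set.univ MeasurableSet.univ, (hQ _).2 ⟨?_, fun i => ?_⟩⟩
      · filter_upwards [Lp.coeFn_smul t (I Set.univ MeasurableSet.univ),
          indicatorConstLp_coeFn (p := 2) (hs := MeasurableSet.univ)
            (hμs := measure_ne_top ν Set.univ) (c := (1:ℝ))] with x hx hx'
        rw [hx, Pi.smul_apply, hx']
        simpa using ⟨ht0, ht1⟩
      · rw [inner_smul_right, real_inner_comm, L2.inner_indicatorConstLp_one]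
        simp [c])
  simp only [hQ] at hf hext
  obtain ⟨hf01, hfc⟩ := hf
  have hfm : Measurable f := (Lp.stronglyMeasurable f).measurable
  -- `f` takes only the values `0` and `1`
  have hzero : ∀ ε : ℝ, 0 < ε → ν {x | ε ≤ f x ∧ f x ≤ 1 - ε} = 0 := by
    intro ε hε
    by_contra hne
    obtain ⟨E, hE1, hE2, hE3, hE4⟩ := exists_pieces ν hν (n+1) {x | ε ≤ f x ∧ f x ≤ 1 - ε}
      ((measurableSet_le measurable_const hfm).inter (measurableSet_le hfm measurable_const))
      (pos_iff_ne_zero.2 hne)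
    let L : (Fin (n+1) → ℝ) →ₗ[ℝ] (Fin n → ℝ) :=
      { toFun := fun a i => ∑ k, a k * inner ℝ (ρ i) (I (E k) (hE2 k))
        map_add' := by intro a b; ext i; simp [add_mul, Finset.sum_add_distrib]
        map_smul' := by intro a b; ext i; simp [Finset.mul_sum, mul_assoc] }
    have hker : LinearMap.ker L ≠ ⊥ := L.ker_ne_bot_of_finrank_lt (by simp)
    obtain ⟨a, ha, ha0⟩ := (Submodule.ne_bot_iff _).1 hker
    obtain ⟨k0, hk0⟩ : ∃ k, a k ≠ 0 := by
      by_contra! h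
      exact ha0 (funext h)
    have hM : 0 < ∑ k, |a k| :=
      lt_of_lt_of_le (abs_pos.2 hk0)
        (Finset.single_le_sum (f := fun k => |a k|) (fun k _ => abs_nonneg _) (Finset.mem_univ k0))
    set M := ∑ k, |a k| with hMdef
    let b : Fin (n+1) → ℝ := fun k => ε / M * a k
    let h : Lp ℝ 2 ν := ∑ k, b k • I (E k) (hE2 k)
    have hhx : ∀ᵐ x ∂ν, h x = ∑ k, b k * (E k).indicator (fun _ => (1:ℝ)) x := by
      have e1 : ∀ᵐ x ∂ν, h x = ∑ k, (b k • I (E k) (hE2 k) : Lp ℝ 2 ν) x := by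
        filter_upwards [Lp.coeFn_finsetSum Finset.univ
          (fun k => (b k • I (E k) (hE2 k) : Lp ℝ 2 ν))] with x hx
        simpa [h] using hx
      have e2 : ∀ᵐ x ∂ν, ∀ k, (b k • I (E k) (hE2 k) : Lp ℝ 2 ν) x
          = b k * (E k).indicator (fun _ => (1:ℝ)) x := by
        rw [ae_all_iff]
        intro k
        filter_upwards [Lp.coeFn_smul (b k) (I (E k) (hE2 k)),
          indicatorConstLp_coeFn (p := 2) (hs := hE2 k)
            (hμs := measure_ne_top ν (E k)) (c := (1:ℝ))] with x hx hx'
        rw [hx, Pi.smul_apply, hx', smul_eq_mul]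
      filter_upwards [e1, e2] with x h1 h2
      rw [h1]
      exact Finset.sum_congr rfl fun k _ => h2 k
    have hbs : ∑ k, |b k| = ε := by
      simp only [b, abs_mul, ← Finset.mul_sum, ← hMdef]
      rw [abs_of_pos (div_pos hε hM)]
      field_simp
    have hbound : ∀ x, |∑ k, b k * (E k).indicator (fun _ => (1:ℝ)) x| ≤ ε := by
      intro x
      rw [← hbs]
      refine (Finset.abs_sum_le_sum_abs _ _).trans (Finset.sum_le_sum fun k _ => ?_)
      by_cases hx : x ∈ E k <;> simp [hx]
    have hoff : ∀ x, ¬ (ε ≤ f x ∧ f x ≤ 1 - ε) →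
        ∑ k, b k * (E k).indicator (fun _ => (1:ℝ)) x = 0 := by
      intro x hx
      refine Finset.sum_eq_zero fun k _ => ?_
      have : x ∉ E k := fun hk => hx (hE1 k hk)
      simp [this]
    have hinner : ∀ i, inner ℝ (ρ i) h = 0 := by
      intro i
      have h1 : L a i = 0 := by
        rw [LinearMap.mem_ker.1 ha]; rfl
      have h2 : inner ℝ (ρ i) h = ε / M * L a i := by
        simp only [h, inner_sum, inner_smul_right, L, LinearMap.coe_mk, AddHom.coe_mk,
          Finset.mul_sum, b, mul_assoc]
      rw [h2, h1, mul_zero]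
    have hh0 : h = 0 := by
      refine hext h ⟨?_, fun i => ?_⟩ ⟨?_, fun i => ?_⟩
      · filter_upwards [hf01, hhx, Lp.coeFn_add f h] with x h1 h2 h3
        rw [h3, Pi.add_apply, h2]
        by_cases hx : ε ≤ f x ∧ f x ≤ 1 - ε
        · have := abs_le.1 (hbound x)
          constructor <;> linarith [this.1, this.2, hx.1, hx.2]
        · rw [hoff x hx, add_zero]; exact h1
      · rw [inner_add_right, hinner, hfc, add_zero]
      · filter_upwards [hf01, hhx, Lp.coeFn_sub f h] with x h1 h2 h3
        rw [h3, Pi.sub_apply, h2]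
        by_cases hx : ε ≤ f x ∧ f x ≤ 1 - ε
        · have := abs_le.1 (hbound x)
          constructor <;> linarith [this.1, this.2, hx.1, hx.2]
        · rw [hoff x hx, sub_zero]; exact h1
      · rw [inner_sub_right, hinner, hfc, sub_zero]
    have hae : ∀ᵐ x ∂ν, x ∉ E k0 := by
      have hz : ∀ᵐ x ∂ν, h x = 0 := by
        rw [hh0]
        filter_upwards [Lp.coeFn_zero ℝ 2 ν] with x hx using hx
      filter_upwards [hz, hhx] with x h1 h2 hx
      rw [h1, Finset.sum_eq_single k0] at h2
      · have : b k0 ≠ 0 := mul_ne_zero (div_pos hε hM).ne' hk0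
        simp [hx, this.symm] at h2
      · intro k _ hk
        have : x ∉ E k := fun hk' => Set.disjoint_left.1 (hE4 hk) hk' hx
        simp [this]
      · simp
    have := hE3 k0
    rw [ae_iff] at hae
    simp only [not_not, Set.ofPred_mem_eq] at hae
    exact this.ne' hae
  have h01 : ∀ᵐ x ∂ν, f x = 0 ∨ f x = 1 := by
    have : ∀ᵐ x ∂ν, ∀ m : ℕ, ¬ (1 / ((m:ℝ) + 1) ≤ f x ∧ f x ≤ 1 - 1 / ((m:ℝ) + 1)) := by
      rw [ae_all_iff]
      intro m
      rw [ae_iff]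
      simpa only [not_not] using hzero (1 / ((m:ℝ) + 1)) (by positivity)
    filter_upwards [this, hf01] with x hx h1
    by_contra! hcon
    have p0 : 0 < f x := lt_of_le_of_ne h1.1 (Ne.symm hcon.1)
    have p1 : 0 < 1 - f x := sub_pos.2 (lt_of_le_of_ne h1.2 hcon.2)
    obtain ⟨m, hm⟩ := exists_nat_one_div_lt (lt_min p0 p1)
    have := lt_min_iff.1 hm
    exact hx m ⟨this.1.le, by linarith [this.2]⟩
  have hA : MeasurableSet {x | f x = 1} := hfm (measurableSet_singleton 1)
  refine ⟨{x | f x = 1}, hA, fun i => ?_⟩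
  have hfI : f = I _ hA := by
    refine Lp.ext ?_
    filter_upwards [h01, indicatorConstLp_coeFn (p := 2) (hs := hA)
            (hμs := measure_ne_top ν _) (c := (1:ℝ))] with x hx hx'
    rw [hx']
    rcases hx with hx | hx <;> simp [Set.indicator, hx]
  have h2 := hfc i
  rw [hfI, real_inner_comm, L2.inner_indicatorConstLp_one] at h2
  exact h2

lemma lyapunov_univ {α : Type*} [MeasurableSpace α] (n : ℕ)
    (μ : Fin n → Measure α) (hfin : ∀ i, IsFiniteMeasure (μ i)) (hna : ∀ i, Nonatomic (μ i))
    (t : ℝ) (ht0 : 0 ≤ t) (ht1 : t ≤ 1) :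
    ∃ A, MeasurableSet A ∧ ∀ i, μ i A = ENNReal.ofReal t * μ i Set.univ := by
  let ν : Measure α := ∑ i, μ i
  have hνf : IsFiniteMeasure ν := inferInstance
  have hνA : ∀ A, ν A = ∑ i, μ i A := fun A => by simp [ν]
  have hle : ∀ i, μ i ≤ ν := fun i => by
    refine Measure.le_iff'.2 fun s => ?_
    rw [hνA]
    exact Finset.single_le_sum (f := fun i => μ i s) (fun _ _ => zero_le) (Finset.mem_univ i)
  have hac : ∀ i, μ i ≪ ν := fun i => Measure.absolutelyContinuous_of_le (hle i)
  have hsplit : ∀ A : Set α, MeasurableSet A → 0 < ν A →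
      ∃ B ⊆ A, MeasurableSet B ∧ 0 < ν B ∧ 0 < ν (A \ B) := by
    intro A hA hpos
    obtain ⟨i, hi⟩ : ∃ i, 0 < μ i A := by
      by_contra! h
      rw [hνA] at hpos
      exact hpos.ne' (Finset.sum_eq_zero fun i _ => le_antisymm (h i) zero_le)
    obtain ⟨B, hBA, hB, h1, h2⟩ := hna i A hA hi
    refine ⟨B, hBA, hB, h1.trans_le (hle i B), lt_of_lt_of_le ?_ (hle i _)⟩
    rw [measure_sdiff hBA hB.nullMeasurableSet (measure_ne_top _ _)]
    exact tsub_pos_of_lt h2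
  have hmem : ∀ i, MemLp (fun x => ((μ i).rnDeriv ν x).toReal) 2 ν := by
    intro i
    refine MemLp.of_bound
      (Measure.measurable_rnDeriv _ _).ennreal_toReal.aestronglyMeasurable 1 ?_
    filter_upwards [Measure.rnDeriv_le_one_of_le (hle i)] with x hx
    rw [Real.norm_of_nonneg ENNReal.toReal_nonneg]
    exact ENNReal.toReal_le_of_le_ofReal zero_le_one (by simpa using hx)
  obtain ⟨A, hA, h⟩ := lyapunov_density ν hsplit n (fun i => (hmem i).toLp) t ht0 ht1
  refine ⟨A, hA, fun i => ?_⟩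
  have e : ∀ B, ∫ x in B, (hmem i).toLp _ x ∂ν = (μ i).real B := by
    intro B
    rw [integral_congr_ae (ae_restrict_of_ae (hmem i).coeFn_toLp)]
    exact Measure.setIntegral_toReal_rnDeriv (hac i) B
  have h1 := h i
  rw [e, ← setIntegral_univ, e] at h1
  rw [← ENNReal.ofReal_toReal (measure_ne_top (μ i) A),
    ← ENNReal.ofReal_toReal (measure_ne_top (μ i) Set.univ), ← ENNReal.ofReal_mul ht0]
  exact congrArg ENNReal.ofReal h1

lemma lyapunov_set {α : Type*} [MeasurableSpace α] (n : ℕ)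
    (μ : Fin n → Measure α) (hfin : ∀ i, IsFiniteMeasure (μ i)) (hna : ∀ i, Nonatomic (μ i))
    (S : Set α) (hS : MeasurableSet S) (t : ℝ) (ht0 : 0 ≤ t) (ht1 : t ≤ 1) :
    ∃ A ⊆ S, MeasurableSet A ∧ ∀ i, μ i A = ENNReal.ofReal t * μ i S := by
  obtain ⟨A, hA, h⟩ := lyapunov_univ n (fun i => (μ i).restrict S)
    (fun i => inferInstance) (by
      intro i A hA hpos
      rw [Measure.restrict_apply hA] at hpos
      obtain ⟨B, hB, hBm, h1, h2⟩ := hna i (A ∩ S) (hA.inter hS) hpos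
      refine ⟨B, hB.trans Set.inter_subset_left, hBm, ?_⟩
      rw [Measure.restrict_apply hBm, Measure.restrict_apply hA,
        Set.inter_eq_left.2 (hB.trans Set.inter_subset_right)]
      exact ⟨h1, h2⟩) t ht0 ht1
  refine ⟨A ∩ S, Set.inter_subset_right, hA.inter hS, fun i => ?_⟩
  have := h i
  rwa [Measure.restrict_apply hA, Measure.restrict_apply_univ] at this

lemma equal_partition {α : Type*} [MeasurableSpace α] (n : ℕ)
    (μ : Fin n → Measure α) (hfin : ∀ i, IsFiniteMeasure (μ i)) (hna : ∀ i, Nonatomic (μ i))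
    (c : Fin n → ENNReal) (m : ℕ) : ∀ (S : Set α), MeasurableSet S → (∀ i, μ i S = m * c i) →
    ∃ R : Fin m → Set α, (∀ k, R k ⊆ S) ∧ (∀ k, MeasurableSet (R k)) ∧
      (∀ k i, μ i (R k) = c i) ∧ Pairwise (Function.onFun Disjoint R) := by
  induction m with
  | zero => exact fun A _ _ => ⟨fun _ => ∅, fun k => k.elim0, fun k => k.elim0, fun k => k.elim0,
      fun k => k.elim0⟩
  | succ m ih =>
    intro S hS hc
    obtain ⟨B, hBS, hB, hBc⟩ := lyapunov_set n μ hfin hna S hS (1 / ((m:ℝ) + 1))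
      (by positivity) (by rw [div_le_one (by positivity)]; linarith [Nat.cast_nonneg (α := ℝ) m])
    have hBc' : ∀ i, μ i B = c i := by
      intro i
      rw [hBc, hc, ← mul_assoc]
      have : ENNReal.ofReal (1 / ((m:ℝ) + 1)) * ((m + 1 : ℕ) : ENNReal) = 1 := by
        rw [← ENNReal.ofReal_natCast, ← ENNReal.ofReal_mul (by positivity)]
        push_cast
        rw [one_div, inv_mul_cancel₀ (by positivity), ENNReal.ofReal_one]
      rw [this, one_mul]
    obtain ⟨R, h1, h2, h3, h4⟩ := ih (S \ B) (hS.diff hB) (by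
      intro i
      rw [measure_sdiff hBS hB.nullMeasurableSet (measure_ne_top _ _), hc, hBc']
      push_cast
      rw [add_mul, one_mul]
      refine ENNReal.add_sub_cancel_right ?_
      rw [← hBc']
      exact measure_ne_top _ _)
    have hd : ∀ k, Disjoint B (R k) := fun k =>
      Set.disjoint_left.2 fun x hx hx' => (h1 k hx').2 hx
    refine ⟨Fin.cons B R, ?_, ?_, ?_, ?_⟩
    · exact Fin.cases hBS fun k => (h1 k).trans Set.sdiff_subset
    · exact Fin.cases hB h2
    · exact Fin.cases hBc' h3
    · intro i j
      refine Fin.cases ?_ (fun i => ?_) i <;> refine Fin.cases ?_ (fun j => ?_) j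
      · exact fun h => absurd rfl h
      · exact fun _ => hd j
      · exact fun _ => (hd i).symm
      · exact fun h => h4 (i := i) (j := j) fun hij => h (congrArg Fin.succ hij)

/-- There exist pairwise disjoint subsets `R^1, …, R^r` of `S` and a renumbering `l` of the
measures such that `μ_{l_k}(R^k) = μ_{l_k}(S)/r` and `μ_{l_j}(R^k) ≤ μ_{l_k}(S)/r`
whenever `j > k`. -/
theorem stmt14 {α : Type*} [MeasurableSpace α] (r : ℕ) (hr : 1 ≤ r)
    (μ : Fin r → Measure α)
    (hfin : ∀ i, IsFiniteMeasure (μ i)) (hna : ∀ i, Nonatomic (μ i))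
    (S : Set α) (hS : MeasurableSet S) (hpos : ∀ i, 0 < μ i S) :
    ∃ (R : Fin r → Set α) (l : Equiv.Perm (Fin r)),
      (∀ k, MeasurableSet (R k)) ∧
      Pairwise (Function.onFun Disjoint R) ∧
      (⋃ k, R k) ⊆ S ∧
      (∀ k, μ (l k) (R k) = μ (l k) S / r) ∧
      (∀ k j, k < j → μ (l j) (R k) ≤ μ (l k) S / r) := by
  have hr0 : (r : ENNReal) ≠ 0 := by
    exact_mod_cast (by omega : r ≠ 0)
  obtain ⟨R, h1, h2, h3, h4⟩ := equal_partition r μ hfin hna (fun i => μ i S / r) r S hS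
    (fun i => (ENNReal.mul_div_cancel hr0 (ENNReal.natCast_ne_top r)).symm)
  let g : Fin r → ENNRealᵒᵈ := fun i => OrderDual.toDual (μ i S)
  refine ⟨R, Tuple.sort g, h2, h4, Set.iUnion_subset h1, fun k => h3 k _, fun k j hkj => ?_⟩
  rw [h3]
  have hm : μ (Tuple.sort g j) S ≤ μ (Tuple.sort g k) S := Tuple.monotone_sort g hkj.le
  exact ENNReal.div_le_div_right hm _
end
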